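/- Suppose char(F_q) > 3. Let r, m, n be integers with m ≥ 1 and 2 ≤ n ≤ r−m, and let L_1,…,L_m be homogeneous linear forms over F_q in the variables A_{r−1},…,A_n in lower-triangular row echelon form: there exist integers 1 ≤ i_1 < ⋯ < i_m ≤ r−n such that each L_j is an F_q-linear combination of A_{r−i_j}, A_{r−i_j+1},…,A_{r−1} in which the coefficient of A_{r−i_j} is nonzero. If either n = 2 and char(F_q) does not divide r(r−1), or n ≥ 3, then L_1,…,L_m satisfy hypotheses (H1)–(H6) (with k := 0 and with G_i := L_i). -/

import Mathlib

open MvPolynomial Polynomial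
open scoped Classical

noncomputable section

/-- The monic polynomial `T^r + a_{r-1} T^{r-1} + ⋯ + a_0` attached to a coefficient
vector `a : Fin r → K` (where `a j` is the coefficient of `T^j`). -/
def monicOfCoeffs {K : Type*} [CommRing K] (r : ℕ) (a : Fin r → K) : Polynomial K :=
  Polynomial.X ^ r + ∑ j : Fin r, Polynomial.C (a j) * Polynomial.X ^ (j : ℕ)

/-- The vanishing ideal of a subset `Z ⊆ K^r`. -/
def vanishingIdealOf (K : Type*) [CommRing K] (r : ℕ) (Z : Set (Fin r → K)) :
    Ideal (MvPolynomial (Fin r) K) where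
  carrier := {p | ∀ x ∈ Z, MvPolynomial.eval x p = 0}
  add_mem' := by
    intro a b ha hb x hx
    simp [map_add, ha x hx, hb x hx]
  zero_mem' := by intro x hx; simp
  smul_mem' := by
    intro c p hp x hx
    simp [smul_eq_mul, map_mul, hp x hx]

/-- The dimension of a subset `Z ⊆ K^r`: the Krull dimension of the quotient of the
polynomial ring over `K` by the vanishing ideal of `Z`. -/
def dimOf (K : Type*) [CommRing K] (r : ℕ) (Z : Set (Fin r → K)) : WithBot ℕ∞ :=
  ringKrullDim (MvPolynomial (Fin r) K ⧸ vanishingIdealOf K r Z)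

/-- `f` has factorization pattern `λ = (λ_1, …, λ_r)`: for each `i`, exactly `λ_i` of the
monic irreducible factors of `f` over `F_q` (counted with multiplicity) have degree `i`.
(The index `i : Fin r` corresponds to the degree `i + 1`.) -/
def HasFactorizationPattern {Fq : Type*} [Field Fq] {r : ℕ}
    (f : Polynomial Fq) (lam : Fin r → ℕ) : Prop :=
  ∀ i : Fin r,
    ((UniqueFactorizationMonoid.normalizedFactors f).filter
      (fun g => g.natDegree = (i : ℕ) + 1)).card = lam i

end

section Dimension

variable {K : Type*} [Field K]

lemma eval_eval_eq {τ ι : Type*} (x : τ → K) (y : ι → MvPolynomial τ K) (F : MvPolynomial ι K) :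
    MvPolynomial.eval (fun i => MvPolynomial.eval x (y i)) F =
      MvPolynomial.eval x (MvPolynomial.aeval y F) := by
  have : (MvPolynomial.eval x).comp (MvPolynomial.aeval y).toRingHom =
      MvPolynomial.eval fun j => MvPolynomial.eval x (y j) := by
    ext j <;> simp
  exact (DFunLike.congr_fun this F).symm

/-- A set of points `Z` has algebraic dimension at most `d`: any `d + 1` polynomial functions
satisfy a common nontrivial polynomial relation on `Z`. -/
def AlgDepOn {τ : Type*} (d : ℕ) (Z : Set (τ → K)) : Prop :=
  ∀ y : Fin (d + 1) → MvPolynomial τ K, ∃ F : MvPolynomial (Fin (d + 1)) K, F ≠ 0 ∧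
    ∀ x ∈ Z, MvPolynomial.eval (fun i => MvPolynomial.eval x (y i)) F = 0

lemma AlgDepOn.union {τ : Type*} {d : ℕ} {Z₁ Z₂ : Set (τ → K)} (h₁ : AlgDepOn d Z₁)
    (h₂ : AlgDepOn d Z₂) : AlgDepOn d (Z₁ ∪ Z₂) := by
  intro y
  obtain ⟨F₁, hF₁, e₁⟩ := h₁ y
  obtain ⟨F₂, hF₂, e₂⟩ := h₂ y
  refine ⟨F₁ * F₂, mul_ne_zero hF₁ hF₂, ?_⟩
  rintro x (hx | hx)
  · simp [e₁ x hx]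
  · simp [e₂ x hx]

lemma AlgDepOn.of_param {σ τ : Type*} {d : ℕ} {Z : Set (σ → K)} {Z' : Set (τ → K)}
    (h : AlgDepOn d Z') (φ : σ → MvPolynomial τ K)
    (hφ : ∀ a ∈ Z, ∃ x ∈ Z', ∀ j, a j = MvPolynomial.eval x (φ j)) : AlgDepOn d Z := by
  intro y
  obtain ⟨F, hF, e⟩ := h fun i => MvPolynomial.aeval φ (y i)
  refine ⟨F, hF, fun a ha => ?_⟩
  obtain ⟨x, hx, hax⟩ := hφ a ha
  obtain rfl : a = fun j => MvPolynomial.eval x (φ j) := funext hax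
  rw [← e x hx]
  congr 2
  exact funext fun i => eval_eval_eq x φ (y i)

lemma AlgDepOn.mono {τ : Type*} {d : ℕ} {Z₁ Z₂ : Set (τ → K)} (h : AlgDepOn d Z₂)
    (h₁₂ : Z₁ ⊆ Z₂) : AlgDepOn d Z₁ := fun y =>
  let ⟨F, hF, e⟩ := h y
  ⟨F, hF, fun x hx => e x (h₁₂ hx)⟩

/-- Krull dimension does not increase along integral extensions. -/
lemma ringKrullDim_le_of_isIntegral {R S : Type*} [CommRing R] [CommRing S] [Algebra R S]
    [Algebra.IsIntegral R S] : ringKrullDim S ≤ ringKrullDim R :=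
  Order.krullDim_le_of_strictMono (PrimeSpectrum.comap (algebraMap R S)) fun p q hpq => by
    exact Ideal.IsIntegral.comap_lt_comap (I := p.asIdeal) (J := q.asIdeal) hpq

lemma dimOf_le_of_algDepOn {r d : ℕ} {Z : Set (Fin r → K)} (h : AlgDepOn d Z) :
    dimOf K r Z ≤ d := by
  unfold dimOf
  cases subsingleton_or_nontrivial (MvPolynomial (Fin r) K ⧸ vanishingIdealOf K r Z)
  · rw [ringKrullDim_eq_bot_of_subsingleton]
    exact bot_le
  obtain ⟨s, g, hinj, hint⟩ := exists_integral_inj_algHom_of_fg K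
    (MvPolynomial (Fin r) K ⧸ vanishingIdealOf K r Z)
  have hs : ringKrullDim (MvPolynomial (Fin r) K ⧸ vanishingIdealOf K r Z) ≤ s := by
    algebraize [g.toRingHom]
    refine ringKrullDim_le_of_isIntegral (R := MvPolynomial (Fin s) K) |>.trans ?_
    simp
  refine hs.trans ?_
  by_contra hlt
  have hds : d + 1 ≤ s := by
    by_contra h'
    exact hlt (by exact_mod_cast (by omega : s ≤ d))
  choose y hy using fun i : Fin (d + 1) =>
    Ideal.Quotient.mk_surjective (g (MvPolynomial.X (Fin.castLE hds i)))
  obtain ⟨F, hF, e⟩ := h y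
  refine hF (MvPolynomial.rename_injective _ (Fin.castLE_injective hds) (hinj ?_))
  have hmem : MvPolynomial.aeval y F ∈ vanishingIdealOf K r Z := by
    intro x hx
    rw [← e x hx, eval_eval_eq]
  rw [map_zero, map_zero, ← (Ideal.Quotient.eq_zero_iff_mem.mpr hmem)]
  have : g.comp (MvPolynomial.rename (Fin.castLE hds)) =
      (Ideal.Quotient.mkₐ K (vanishingIdealOf K r Z)).comp (MvPolynomial.aeval y) := by
    ext j
    simpa using (hy j).symm
  exact DFunLike.congr_fun this F

lemma algDepOn_of_not_algebraicIndependent {τ : Type*} {d : ℕ} {Z : Set (τ → K)}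
    (J : Ideal (MvPolynomial τ K)) (hJ : ∀ x ∈ Z, ∀ p ∈ J, MvPolynomial.eval x p = 0)
    (h : ∀ y : Fin (d + 1) → MvPolynomial τ K ⧸ J, ¬ AlgebraicIndependent K y) :
    AlgDepOn d Z := by
  intro y
  have := h (fun i => Ideal.Quotient.mkₐ K J (y i))
  rw [algebraicIndependent_iff] at this
  push Not at this
  obtain ⟨F, hF, hne⟩ := this
  refine ⟨F, hne, fun x hx => ?_⟩
  rw [eval_eval_eq]
  refine hJ x hx _ ?_
  rw [← Ideal.Quotient.eq_zero_iff_mem, ← hF]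
  have : (Ideal.Quotient.mkₐ K J).comp (MvPolynomial.aeval y) =
    MvPolynomial.aeval fun i => Ideal.Quotient.mkₐ K J (y i) := by
    ext; simp
  exact DFunLike.congr_fun this F

lemma algDepOn_univ {τ : Type*} [Fintype τ] {d : ℕ} (hd : Fintype.card τ ≤ d)
    (Z : Set (τ → K)) : AlgDepOn d Z := by
  intro y
  have : ¬ AlgebraicIndependent K y := fun hy => by
    have := hy.lift_cardinalMk_le_trdeg
    simp only [MvPolynomial.trdeg_of_isDomain, Cardinal.mk_fintype, Fintype.card_fin,
      Cardinal.lift_natCast] at this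
    have : d + 1 ≤ Fintype.card τ := by exact_mod_cast this
    omega
  rw [algebraicIndependent_iff] at this
  push Not at this
  obtain ⟨F, hF, hne⟩ := this
  refine ⟨F, hne, fun x _ => ?_⟩
  rw [eval_eval_eq, hF, map_zero]

lemma algDepOn_of_hypersurface {τ : Type*} [Fintype τ] {d : ℕ} (hd : Fintype.card τ ≤ d + 1)
    {Z : Set (τ → K)} (p : MvPolynomial τ K) (hp : ∃ x, MvPolynomial.eval x p ≠ 0)
    (hZ : ∀ x ∈ Z, MvPolynomial.eval x p = 0) : AlgDepOn d Z := by
  intro y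
  have hp0 : p ≠ 0 := by
    rintro rfl
    simp at hp
  by_cases hy : AlgebraicIndependent K y
  · have htb : IsTranscendenceBasis K y := by
      refine hy.isTranscendenceBasis_of_lift_trdeg_le_of_finite ?_
      simp only [MvPolynomial.trdeg_of_isDomain, Cardinal.mk_fintype, Fintype.card_fin,
        Cardinal.lift_natCast]
      exact_mod_cast hd
    have := htb.isAlgebraic
    obtain ⟨⟨q, hq⟩, hq0, hdvd⟩ := (Algebra.IsAlgebraic.isAlgebraic
      (R := Algebra.adjoin K (Set.range y)) p).exists_nonzero_dvd
        (mem_nonZeroDivisors_of_ne_zero hp0)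
    rw [Algebra.adjoin_range_eq_range_aeval] at hq
    obtain ⟨F, rfl⟩ := hq
    refine ⟨F, ?_, fun x hx => ?_⟩
    · rintro rfl
      exact hq0 (Subtype.ext (map_zero (MvPolynomial.aeval y)))
    · rw [eval_eval_eq]
      obtain ⟨u, hu⟩ := hdvd
      have hu : MvPolynomial.aeval y F = p * u := hu
      rw [hu, map_mul, hZ x hx, zero_mul]
  · rw [algebraicIndependent_iff] at hy
    push Not at hy
    obtain ⟨F, hF, hne⟩ := hy
    refine ⟨F, hne, fun x _ => ?_⟩
    rw [eval_eval_eq, hF, map_zero]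

/-- If `B` is integral over the image of a polynomial ring in finitely many variables, then `B`
has no more algebraically independent elements than there are variables. -/
lemma not_algebraicIndependent_of_isIntegral {S B : Type*} [Fintype S] [CommRing B] [Algebra K B]
    (f : MvPolynomial S K →ₐ[K] B) (hf : f.toRingHom.IsIntegral) {d : ℕ} (hd : Fintype.card S ≤ d)
    (y : Fin (d + 1) → B) : ¬ AlgebraicIndependent K y := by
  intro hy
  have hinj : Function.Injective (MvPolynomial.aeval (R := K) y).toRingHom := hy
  obtain ⟨P, hP, hPc⟩ := Ideal.exists_comap_eq_of_mem_minimalPrimes_of_injective hinj ⊥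
    (by rw [IsDomain.minimalPrimes_eq_singleton_bot]; rfl)
  have hyP : AlgebraicIndependent K fun i => Ideal.Quotient.mkₐ K P (y i) := by
    rw [algebraicIndependent_iff]
    intro F hF
    have hmem : F ∈ P.comap (MvPolynomial.aeval (R := K) y).toRingHom := by
      rw [Ideal.mem_comap, ← Ideal.Quotient.eq_zero_iff_mem, ← hF]
      have : (Ideal.Quotient.mkₐ K P).comp (MvPolynomial.aeval y) =
        MvPolynomial.aeval fun i => Ideal.Quotient.mkₐ K P (y i) := by
        ext; simp
      exact DFunLike.congr_fun this F
    rwa [hPc] at hmem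
  let g := (Ideal.Quotient.mkₐ K P).comp f
  have hg : g.toRingHom.IsIntegral :=
    hf.trans _ _ (RingHom.isIntegral_of_surjective _ (Ideal.Quotient.mkₐ_surjective K P))
  let s : Set (B ⧸ P) := Set.range fun v : S => g (MvPolynomial.X v)
  have hrange : Algebra.adjoin K s = g.range := by
    rw [Algebra.adjoin_range_eq_range_aeval]
    congr 1
    ext; simp
  have halg : Algebra.IsAlgebraic (Algebra.adjoin K s) (B ⧸ P) := by
    rw [hrange]
    refine ⟨fun b => IsIntegral.isAlgebraic ?_⟩
    obtain ⟨q, hq, hqb⟩ := hg b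
    refine ⟨q.map g.rangeRestrict.toRingHom, hq.map _, ?_⟩
    rw [Polynomial.eval₂_map]
    exact hqb
  have h1 := Algebra.IsAlgebraic.trdeg_le_cardinalMk K s
  have h2 := hyP.lift_cardinalMk_le_trdeg
  have h3 : Cardinal.mk s ≤ (Fintype.card S : Cardinal) := by
    rw [← Nat.cast_card, ← Nat.card_eq_fintype_card]
    exact_mod_cast Finite.card_range_le _
  have h4 := h2.trans (Cardinal.lift_le.mpr (h1.trans h3))
  simp only [Cardinal.mk_fintype, Fintype.card_fin, Cardinal.lift_natCast] at h4
  have : d + 1 ≤ Fintype.card S := by exact_mod_cast h4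
  omega

end Dimension

section Echelon

/-- The ideal generated by a set of variables is prime. -/
lemma isPrime_span_X_image {σ R : Type*} [CommRing R] [IsDomain R] (s : Set σ) :
    (Ideal.span (MvPolynomial.X '' s : Set (MvPolynomial σ R))).IsPrime := by
  let ψ : MvPolynomial σ R →ₐ[R] MvPolynomial σ R :=
    MvPolynomial.aeval fun v => if v ∈ s then 0 else MvPolynomial.X v
  set I := Ideal.span (MvPolynomial.X '' s : Set (MvPolynomial σ R)) with hI
  have hmk : (Ideal.Quotient.mkₐ R I).comp ψ = Ideal.Quotient.mkₐ R I := by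
    ext v
    by_cases hv : v ∈ s
    · have : Ideal.Quotient.mk I (MvPolynomial.X v) = 0 :=
        Ideal.Quotient.eq_zero_iff_mem.mpr (Ideal.subset_span ⟨v, hv, rfl⟩)
      simp [ψ, hv, this]
    · simp [ψ, hv]
  have : I = RingHom.ker ψ := by
    refine le_antisymm (Ideal.span_le.mpr ?_) fun p hp => ?_
    · rintro _ ⟨v, hv, rfl⟩
      simp [ψ, hv]
    · have h := DFunLike.congr_fun hmk p
      rw [AlgHom.comp_apply, (RingHom.mem_ker).mp hp, map_zero] at h
      exact Ideal.Quotient.eq_zero_iff_mem.mp h.symm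
  rw [this]
  exact RingHom.ker_isPrime _

/-- The automorphism of a polynomial ring given by an invertible linear substitution. -/
noncomputable def linearSubstEquiv {σ R : Type*} [Fintype σ] [DecidableEq σ] [CommRing R]
    (M : Matrix σ σ R) (hM : IsUnit M) : MvPolynomial σ R ≃ₐ[R] MvPolynomial σ R :=
  AlgEquiv.ofAlgHom (MvPolynomial.bind₁ M.toMvPolynomial) (MvPolynomial.bind₁ M⁻¹.toMvPolynomial)
    (by
      ext1 v
      simp [← Matrix.toMvPolynomial_mul, Matrix.toMvPolynomial_one,
        Matrix.nonsing_inv_mul _ ((Matrix.isUnit_iff_isUnit_det M).mp hM)])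
    (by
      ext1 v
      simp [← Matrix.toMvPolynomial_mul, Matrix.toMvPolynomial_one,
        Matrix.mul_nonsing_inv _ ((Matrix.isUnit_iff_isUnit_det M).mp hM)])

lemma isRegular_ofFn_toMvPolynomial {σ F : Type*} [Fintype σ] [DecidableEq σ] [Field F]
    (M : Matrix σ σ F) (hM : IsUnit M) {m : ℕ} (piv : Fin m → σ) (hpiv : Function.Injective piv) :
    RingTheory.Sequence.IsRegular (MvPolynomial σ F)
      (List.ofFn fun t => M.toMvPolynomial (piv t)) := by
  set e := linearSubstEquiv M hM
  have he : ∀ v, M.toMvPolynomial v = e (MvPolynomial.X v) := fun v => by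
    simp [e, linearSubstEquiv]
  have hmap : ∀ s : Set σ, Ideal.span ((fun v => M.toMvPolynomial v) '' s) =
      (Ideal.span (MvPolynomial.X '' s : Set (MvPolynomial σ F))).map e := fun s => by
    rw [Ideal.map_span, Set.image_image]
    simp [he]
  have hprime : ∀ s : Set σ, (Ideal.span ((fun v => M.toMvPolynomial v) '' s)).IsPrime :=
    fun s => by
      rw [hmap]
      have := isPrime_span_X_image (R := F) s
      exact Ideal.map_isPrime_of_equiv e
  have hmem : ∀ (s : Set σ) (v : σ), v ∉ s →
      M.toMvPolynomial v ∉ Ideal.span ((fun v => M.toMvPolynomial v) '' s) := fun s v hv h => by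
    rw [hmap, he] at h
    obtain ⟨x, hx, hxe⟩ := (Ideal.mem_map_of_equiv e _).mp h
    rw [e.injective hxe, MvPolynomial.mem_ideal_span_X_image] at hx
    obtain ⟨i, hi, hi'⟩ := hx (Finsupp.single v 1) (by simp [MvPolynomial.mem_support_iff])
    rw [Finsupp.single_apply_ne_zero] at hi'
    exact hv (hi'.1 ▸ hi)
  refine ⟨⟨fun i hi => ?_⟩, ?_⟩
  · rw [List.length_ofFn] at hi
    have hI : Ideal.ofList ((List.ofFn fun t => M.toMvPolynomial (piv t)).take i) =
        Ideal.span ((fun v => M.toMvPolynomial v) '' (piv '' {t | (t : ℕ) < i})) := by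
      refine congrArg Ideal.span (Set.ext fun p => ?_)
      simp only [Set.mem_ofPred_eq, List.mem_take_iff_getElem, List.getElem_ofFn, List.length_ofFn,
        Set.mem_image, exists_exists_and_eq_and]
      constructor
      · rintro ⟨j, hj, rfl⟩
        exact ⟨⟨j, by omega⟩, by simp; omega, rfl⟩
      · rintro ⟨t, ht, rfl⟩
        exact ⟨t, by have := t.2; omega, rfl⟩
    rw [isSMulRegular_quotient_iff_mem_of_smul_mem, hI, smul_eq_mul, Ideal.mul_top]
    intro p hp
    refine ((hprime _).mem_or_mem hp).resolve_left ?_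
    rw [List.getElem_ofFn]
    refine hmem _ _ ?_
    rintro ⟨t, ht, hti⟩
    have := hpiv hti
    subst this
    simp at ht
  · have hI : Ideal.ofList (List.ofFn fun t => M.toMvPolynomial (piv t)) =
        Ideal.span ((fun v => M.toMvPolynomial v) '' (Set.range piv)) := by
      refine congrArg Ideal.span (Set.ext fun p => ?_)
      simp [List.mem_ofFn]
    rw [hI, smul_eq_mul, Ideal.mul_top]
    exact (hprime _).ne_top.symm

lemma eq_sum_of_isHomogeneous_one {σ R : Type*} [Fintype σ] [CommSemiring R]
    {p : MvPolynomial σ R} (hp : p.IsHomogeneous 1) :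
    p = ∑ v, MvPolynomial.C (MvPolynomial.coeff (Finsupp.single v 1) p) * MvPolynomial.X v := by
  have h : p ∈ MvPolynomial.homogeneousSubmodule σ R 1 := hp
  rw [MvPolynomial.homogeneousSubmodule_one_eq_span_X] at h
  induction h using Submodule.span_induction with
  | mem x hx =>
    obtain ⟨v, rfl⟩ := hx
    simp [MvPolynomial.coeff_X, Finsupp.single_left_inj]
  | zero => simp
  | add x y hx hy ihx ihy =>
    rw [← MvPolynomial.homogeneousSubmodule_one_eq_span_X] at hx hy
    conv_lhs => rw [ihx hx, ihy hy]
    simp [add_mul, Finset.sum_add_distrib]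
  | smul c x hx ih =>
    rw [← MvPolynomial.homogeneousSubmodule_one_eq_span_X] at hx
    conv_lhs => rw [ih hx]
    simp [Finset.smul_sum, MvPolynomial.smul_eq_C_mul, mul_assoc]

variable {σ F : Type*} [Field F] {m : ℕ}

/-- The square matrix whose row at the pivot `piv t` consists of the coefficients of the linear form
`L t`, and whose other rows are those of the identity matrix. -/
noncomputable def echelonMatrix [DecidableEq σ] (L : Fin m → MvPolynomial σ F) (piv : Fin m → σ) :
    Matrix σ σ F :=
  Matrix.of (Function.extend piv (fun t v => MvPolynomial.coeff (Finsupp.single v 1) (L t))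
    fun v w => (1 : Matrix σ σ F) v w)

lemma echelonMatrix_piv [DecidableEq σ] (L : Fin m → MvPolynomial σ F) {piv : Fin m → σ}
    (hinj : Function.Injective piv) (t : Fin m) (v : σ) :
    echelonMatrix L piv (piv t) v = MvPolynomial.coeff (Finsupp.single v 1) (L t) := by
  rw [echelonMatrix, Matrix.of_apply, hinj.extend_apply]

lemma echelonMatrix_of_notMem [DecidableEq σ] (L : Fin m → MvPolynomial σ F) {piv : Fin m → σ}
    {v : σ} (hv : v ∉ Set.range piv) (w : σ) :
    echelonMatrix L piv v w = (1 : Matrix σ σ F) v w := by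
  rw [echelonMatrix, Matrix.of_apply, Function.extend_apply' _ _ _ hv]

lemma toMvPolynomial_echelonMatrix [Fintype σ] [DecidableEq σ] {L : Fin m → MvPolynomial σ F}
    {piv : Fin m → σ} (hinj : Function.Injective piv) (hhom : ∀ t, (L t).IsHomogeneous 1)
    (t : Fin m) :
    (echelonMatrix L piv).toMvPolynomial (piv t) = L t := by
  rw [eq_sum_of_isHomogeneous_one (hhom t), Matrix.toMvPolynomial]
  refine Finset.sum_congr rfl fun v _ => ?_
  rw [echelonMatrix_piv L hinj, MvPolynomial.C_mul_X_eq_monomial]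

variable [LinearOrder σ]

/-- A family of linear forms in lower-triangular row echelon form with given pivots. -/
structure IsEchelonFamily (L : Fin m → MvPolynomial σ F) (piv : Fin m → σ) : Prop where
  injective : Function.Injective piv
  isHomogeneous : ∀ t, (L t).IsHomogeneous 1
  le_of_coeff_ne_zero : ∀ t v, MvPolynomial.coeff (Finsupp.single v 1) (L t) ≠ 0 → piv t ≤ v
  coeff_piv_ne_zero : ∀ t, MvPolynomial.coeff (Finsupp.single (piv t) 1) (L t) ≠ 0

namespace IsEchelonFamily

variable {L : Fin m → MvPolynomial σ F} {piv : Fin m → σ}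

lemma isUpperTriangular (h : IsEchelonFamily L piv) :
    (echelonMatrix L piv).IsUpperTriangular := by
  intro v w hwv
  by_cases hv : v ∈ Set.range piv
  · obtain ⟨t, rfl⟩ := hv
    rw [echelonMatrix_piv L h.injective]
    by_contra hne
    exact absurd (h.le_of_coeff_ne_zero t w hne) (not_le.mpr hwv)
  · rw [echelonMatrix_of_notMem L hv]
    exact Matrix.one_apply_ne (ne_of_gt hwv)

variable [Fintype σ]

lemma isUnit_echelonMatrix (h : IsEchelonFamily L piv) : IsUnit (echelonMatrix L piv) := by
  rw [Matrix.isUnit_iff_isUnit_det, isUnit_iff_ne_zero,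
    Matrix.det_of_isUpperTriangular h.isUpperTriangular, Finset.prod_ne_zero_iff]
  intro v _
  by_cases hv : v ∈ Set.range piv
  · obtain ⟨t, rfl⟩ := hv
    rw [echelonMatrix_piv L h.injective]
    exact h.coeff_piv_ne_zero t
  · rw [echelonMatrix_of_notMem L hv]
    simp

lemma isRegular (h : IsEchelonFamily L piv) :
    RingTheory.Sequence.IsRegular (MvPolynomial σ F) (List.ofFn L) := by
  have := isRegular_ofFn_toMvPolynomial _ h.isUnit_echelonMatrix piv h.injective
  simpa only [toMvPolynomial_echelonMatrix h.injective h.isHomogeneous] using this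

variable {K : Type*} [Field K] [Algebra F K]

lemma rank_jacobian (h : IsEchelonFamily L piv) (a : σ → K) :
    Matrix.rank (Matrix.of fun (i : Fin m) (j : σ) => MvPolynomial.eval a
      (MvPolynomial.pderiv j (MvPolynomial.map (algebraMap F K) (L i)))) = m := by
  have hM : IsUnit ((echelonMatrix L piv).map (algebraMap F K)) :=
    h.isUnit_echelonMatrix.map (algebraMap F K).mapMatrix
  have hrows := (Matrix.linearIndependent_rows_of_isUnit hM).comp piv h.injective
  refine LinearIndependent.rank_matrix (M := Matrix.of _) ?_ |>.trans (by simp)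
  convert hrows using 1
  funext i j
  change MvPolynomial.eval a (MvPolynomial.pderiv j (MvPolynomial.map (algebraMap F K) (L i))) =
    algebraMap F K (echelonMatrix L piv (piv i) j)
  rw [echelonMatrix_piv L h.injective]
  conv_lhs => rw [eq_sum_of_isHomogeneous_one (h.isHomogeneous i)]
  simp [MvPolynomial.pderiv_X, Pi.single_apply]

/-- On the common zero set of an echelon family, all coordinates are linear combinations of
non-pivot coordinates of at least the same index. -/
lemma exists_parametrization (h : IsEchelonFamily L piv) :
    ∃ N : Matrix σ σ F, (∀ v s, s < v → N v s = 0) ∧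
      (∀ v, v ∉ Set.range piv → ∀ s, N v s = if v = s then 1 else 0) ∧
      ∀ a : σ → K, (∀ t, MvPolynomial.eval a (MvPolynomial.map (algebraMap F K) (L t)) = 0) →
        ∀ v, a v = ∑ s, if s ∈ Set.range piv then 0 else algebraMap F K (N v s) * a s := by
  have hu := h.isUnit_echelonMatrix
  have hdet := (Matrix.isUnit_iff_isUnit_det _).mp hu
  refine ⟨(echelonMatrix L piv)⁻¹, ?_, ?_, ?_⟩
  · have := hu.invertible
    intro v s hsv
    exact Matrix.blockTriangular_inv_of_blockTriangular h.isUpperTriangular hsv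
  · intro v hv s
    rw [← Matrix.one_apply, ← Matrix.mul_nonsing_inv _ hdet, Matrix.mul_apply]
    simp [echelonMatrix_of_notMem L hv, Matrix.one_apply]
  · intro a ha v
    set M := (echelonMatrix L piv).map (algebraMap F K)
    set N := ((echelonMatrix L piv)⁻¹).map (algebraMap F K)
    have hNM : N * M = 1 := by
      rw [← Matrix.map_mul, Matrix.nonsing_inv_mul _ hdet]
      simp
    have hMa : ∀ s, M.mulVec a s = if s ∈ Set.range piv then 0 else a s := by
      intro s
      split_ifs with hs
      · obtain ⟨t, rfl⟩ := hs
        rw [← ha t, ← toMvPolynomial_echelonMatrix h.injective h.isHomogeneous,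
          ← Matrix.toMvPolynomial_map, Matrix.toMvPolynomial_eval_eq_apply]
      · simp [M, Matrix.mulVec, dotProduct, echelonMatrix_of_notMem L hs, Matrix.one_apply]
    conv_lhs => rw [← Matrix.one_mulVec a, ← hNM, ← Matrix.mulVec_mulVec]
    rw [Matrix.mulVec, dotProduct]
    refine Finset.sum_congr rfl fun s _ => ?_
    rw [hMa]
    split_ifs <;> simp [N]

end IsEchelonFamily

end Echelon

section DegreeFiltration

variable {A B : Type*} [CommRing A] [CommRing B] [Algebra A B] {α β : B}

variable (A α β) in
/-- The `A`-submodule of polynomial expressions in `α` and `β` of total degree at most `k`. -/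
def degreeFiltration (k : ℕ) : Submodule A B :=
  Submodule.span A {x | ∃ i j, i + j ≤ k ∧ x = α ^ i * β ^ j}

lemma pow_mul_pow_mem_degreeFiltration {i j k : ℕ} (h : i + j ≤ k) :
    α ^ i * β ^ j ∈ degreeFiltration A α β k :=
  Submodule.subset_span ⟨i, j, h, rfl⟩

lemma pow_left_mem_degreeFiltration {i k : ℕ} (h : i ≤ k) : α ^ i ∈ degreeFiltration A α β k := by
  simpa using pow_mul_pow_mem_degreeFiltration (A := A) (α := α) (β := β) (i := i) (j := 0) h

lemma pow_right_mem_degreeFiltration {j k : ℕ} (h : j ≤ k) : β ^ j ∈ degreeFiltration A α β k := by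
  simpa using pow_mul_pow_mem_degreeFiltration (A := A) (α := α) (β := β) (i := 0) (j := j)
    (by omega)

lemma mul_mem_degreeFiltration {k l N : ℕ} {x y : B} (hx : x ∈ degreeFiltration A α β k)
    (hy : y ∈ degreeFiltration A α β l) (h : k + l ≤ N) :
    x * y ∈ degreeFiltration A α β N := by
  have := Submodule.mul_mem_mul hx hy
  rw [degreeFiltration, degreeFiltration, Submodule.span_mul_span] at this
  refine Submodule.span_mono ?_ this
  rintro _ ⟨_, ⟨i, j, hij, rfl⟩, _, ⟨i', j', hij', rfl⟩, rfl⟩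
  exact ⟨i + i', j + j', by omega, by ring⟩

lemma fg_degreeFiltration (k : ℕ) : (degreeFiltration A α β k).FG := by
  refine Submodule.fg_span (Set.Finite.subset
    (((Set.finite_Iic k).prod (Set.finite_Iic k)).image fun p => α ^ p.1 * β ^ p.2) ?_)
  rintro _ ⟨i, j, hij, rfl⟩
  exact ⟨(i, j), ⟨by simp; omega, by simp; omega⟩, rfl⟩

/-- If sufficiently high powers of `α` and `β` are expressions of lower degree, then `α` and `β` are
integral. -/
lemma isIntegral_of_pow_mem_degreeFiltration {P : ℕ}
    (hα : α ^ (P + 1) ∈ degreeFiltration A α β P) (hβ : β ^ (P + 1) ∈ degreeFiltration A α β P) :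
    IsIntegral A α ∧ IsIntegral A β := by
  set M := degreeFiltration A α β (2 * P + 1)
  have hstep : ∀ l, degreeFiltration A α β (2 * P + 1 + l) ≤ M := by
    intro l
    induction l with
    | zero => exact le_rfl
    | succ l ih =>
      refine le_trans (Submodule.span_le.mpr ?_) ih
      rintro _ ⟨i, j, hij, rfl⟩
      by_cases hi : P + 1 ≤ i
      · obtain ⟨i, rfl⟩ := Nat.exists_eq_add_of_le hi
        rw [pow_add, mul_assoc]
        exact mul_mem_degreeFiltration hα (pow_mul_pow_mem_degreeFiltration le_rfl) (by omega)
      · by_cases hj : P + 1 ≤ j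
        · obtain ⟨j, rfl⟩ := Nat.exists_eq_add_of_le hj
          rw [pow_add, mul_left_comm]
          exact mul_mem_degreeFiltration hβ (pow_mul_pow_mem_degreeFiltration le_rfl) (by omega)
        · exact pow_mul_pow_mem_degreeFiltration (by omega)
  let S : Subalgebra A B := M.toSubalgebra
    (by simpa using pow_left_mem_degreeFiltration (A := A) (α := α) (β := β) (Nat.zero_le _))
    fun x y hx hy => hstep (2 * P + 1) (mul_mem_degreeFiltration hx hy le_rfl)
  have hS : S.toSubmodule.FG := by
    simpa [S] using fg_degreeFiltration (A := A) (α := α) (β := β) (2 * P + 1)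
  refine ⟨IsIntegral.of_mem_of_fg S hS _ ?_, IsIntegral.of_mem_of_fg S hS _ ?_⟩
  · show α ∈ M
    simpa using pow_left_mem_degreeFiltration (A := A) (α := α) (β := β) (i := 1)
      (k := 2 * P + 1) (by omega)
  · show β ∈ M
    simpa using pow_right_mem_degreeFiltration (A := A) (α := α) (β := β) (j := 1)
      (k := 2 * P + 1) (by omega)

lemma isIntegral_of_two_double_roots {r : ℕ} (hr : 3 ≤ r) (hr0 : IsUnit (r : A))
    (hr1 : IsUnit ((r : A) - 1))
    (h1 : (r : B) * (α ^ (r - 1) - β ^ (r - 1)) ∈ degreeFiltration A α β (r - 2))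
    (h2 : (r : B) * ∑ i ∈ Finset.range (r - 1), α ^ i * β ^ (r - 2 - i) ∈
      degreeFiltration A α β (r - 3))
    (h3 : α ^ r - β ^ r - (α - β) * ((r : B) * α ^ (r - 1)) ∈ degreeFiltration A α β (r - 1)) :
    IsIntegral A α ∧ IsIntegral A β := by
  obtain ⟨s, rfl⟩ := Nat.exists_eq_add_of_le' hr
  simp only [show s + 3 - 1 = s + 2 by omega, show s + 3 - 2 = s + 1 by omega,
    show s + 3 - 3 = s by omega] at h1 h2 h3
  have hcancel : ∀ {c : A} {x : B} {k : ℕ}, IsUnit c →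
      algebraMap A B c * x ∈ degreeFiltration A α β k → x ∈ degreeFiltration A α β k := by
    rintro c x k ⟨u, rfl⟩ hx
    rw [← Algebra.smul_def] at hx
    exact (Submodule.smul_mem_iff_of_isUnit _ u.isUnit).mp hx
  have e1 : α ^ (s + 2) - β ^ (s + 2) ∈ degreeFiltration A α β (s + 1) :=
    hcancel hr0 (by rwa [map_natCast])
  have e2 : ∑ i ∈ Finset.range (s + 2), α ^ i * β ^ (s + 1 - i) ∈ degreeFiltration A α β s :=
    hcancel hr0 (by rwa [map_natCast])
  have e3 : (α - β) * α ^ (s + 2) ∈ degreeFiltration A α β (s + 2) := by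
    refine hcancel hr1 ?_
    have := mul_mem_degreeFiltration (N := s + 2) (pow_right_mem_degreeFiltration
      (A := A) (α := α) (β := β) (j := 1) le_rfl) e1 (by omega)
    have := Submodule.sub_mem _ this h3
    convert this using 1
    rw [map_sub, map_natCast, map_one]
    push_cast
    ring
  have e4 : ∀ i j : ℕ, α ^ (s + 2) * (α ^ i * β ^ j) - α ^ (s + 2 + (i + j)) ∈
      degreeFiltration A α β (s + 1 + (i + j)) := by
    intro i j
    induction j with
    | zero => simp [pow_add]
    | succ j ih =>
      have a1 := mul_mem_degreeFiltration (N := s + 1 + (i + (j + 1))) e3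
        (pow_mul_pow_mem_degreeFiltration (i := i) (j := j) le_rfl) (by omega)
      have a2 := mul_mem_degreeFiltration (N := s + 1 + (i + (j + 1))) ih
        (pow_left_mem_degreeFiltration (A := A) (α := α) (β := β) (i := 1) le_rfl) (by omega)
      convert Submodule.sub_mem _ a2 a1 using 1
      ring
  have e5 : α ^ (2 * s + 3) ∈ degreeFiltration A α β (2 * s + 2) := by
    refine hcancel hr1 ?_
    have a1 := mul_mem_degreeFiltration (N := 2 * s + 2)
      (pow_left_mem_degreeFiltration (A := A) (α := α) (β := β) (i := s + 2) le_rfl) e2 (by omega)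
    have a2 : ∑ i ∈ Finset.range (s + 2), (α ^ (s + 2) * (α ^ i * β ^ (s + 1 - i)) -
        α ^ (2 * s + 3)) ∈ degreeFiltration A α β (2 * s + 2) := by
      refine Submodule.sum_mem _ fun i hi => ?_
      have hi := Finset.mem_range.mp hi
      have := e4 i (s + 1 - i)
      rwa [show s + 2 + (i + (s + 1 - i)) = 2 * s + 3 by omega,
        show s + 1 + (i + (s + 1 - i)) = 2 * s + 2 by omega] at this
    convert Submodule.sub_mem _ a1 a2 using 1
    rw [Finset.sum_sub_distrib, ← Finset.mul_sum, map_sub, map_natCast, map_one]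
    simp only [Finset.sum_const, Finset.card_range, nsmul_eq_mul]
    push_cast
    ring
  have e6 : α ^ (2 * s + 3 + 1) ∈ degreeFiltration A α β (2 * s + 3) := by
    rw [pow_succ]
    exact mul_mem_degreeFiltration e5
      (by simpa using pow_left_mem_degreeFiltration (A := A) (α := α) (β := β) (i := 1) le_rfl)
      (by omega)
  refine isIntegral_of_pow_mem_degreeFiltration e6 ?_
  have a1 := mul_mem_degreeFiltration (N := 2 * s + 3) e1
    (pow_left_mem_degreeFiltration (A := A) (α := α) (β := β) (i := s + 2) le_rfl) (by omega)
  have a2 := mul_mem_degreeFiltration (N := 2 * s + 3) e1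
    (pow_right_mem_degreeFiltration (A := A) (α := α) (β := β) (j := s + 2) le_rfl) (by omega)
  convert Submodule.sub_mem _ (Submodule.sub_mem _ e6 a1) a2 using 1
  ring

end DegreeFiltration

section MonicOfCoeffs

variable {R R' : Type*} [CommRing R] [CommRing R'] {r : ℕ}

lemma map_monicOfCoeffs (g : R →+* R') (c : Fin r → R) :
    (monicOfCoeffs r c).map g = monicOfCoeffs r fun j => g (c j) := by
  simp [monicOfCoeffs, Polynomial.map_sum]

lemma eval_monicOfCoeffs (c : Fin r → R) (α : R) :
    (monicOfCoeffs r c).eval α = α ^ r + ∑ j, c j * α ^ (j : ℕ) := by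
  simp [monicOfCoeffs, Polynomial.eval_finsetSum]

lemma eval_derivative_monicOfCoeffs (c : Fin r → R) (α : R) :
    (monicOfCoeffs r c).derivative.eval α =
      r * α ^ (r - 1) + ∑ j : Fin r, c j * ((j : ℕ) * α ^ ((j : ℕ) - 1)) := by
  simp [monicOfCoeffs, Polynomial.eval_finsetSum, Polynomial.derivative_X_pow]

/-- The divided difference of the derivative of `monicOfCoeffs r c` at `α` and `β`. -/
def derivativeDividedDiff (c : Fin r → R) (α β : R) : R :=
  r * ∑ i ∈ Finset.range (r - 1), α ^ i * β ^ (r - 2 - i) +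
    ∑ j : Fin r, c j * ((j : ℕ) * ∑ i ∈ Finset.range (j - 1), α ^ i * β ^ ((j : ℕ) - 2 - i))

lemma derivativeDividedDiff_mul_sub (c : Fin r → R) (α β : R) :
    derivativeDividedDiff c α β * (α - β) =
      (monicOfCoeffs r c).derivative.eval α - (monicOfCoeffs r c).derivative.eval β := by
  have h : ∀ k : ℕ, (∑ i ∈ Finset.range (k - 1), α ^ i * β ^ (k - 2 - i)) * (α - β) =
      α ^ (k - 1) - β ^ (k - 1) := fun k => by
    rw [← geom_sum₂_mul]
    rfl
  simp only [derivativeDividedDiff, eval_derivative_monicOfCoeffs, add_mul, Finset.sum_mul,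
    mul_assoc, h]
  simp only [mul_sub, Finset.sum_sub_distrib]
  ring

lemma map_derivativeDividedDiff (g : R →+* R') (c : Fin r → R) (α β : R) :
    g (derivativeDividedDiff c α β) =
      derivativeDividedDiff (fun j => g (c j)) (g α) (g β) := by
  simp [derivativeDividedDiff]

lemma isIntegral_of_derivativeDividedDiff_eq_zero {A B : Type*} [CommRing A] [CommRing B]
    [Algebra A B] (hr : 3 ≤ r) (hr0 : IsUnit (r : A)) (hr1 : IsUnit ((r : A) - 1)) (c : Fin r → A)
    {α β : B} (h1 : derivativeDividedDiff (fun j => algebraMap A B (c j)) α β = 0)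
    (h2 : (monicOfCoeffs r fun j => algebraMap A B (c j)).eval α -
      (monicOfCoeffs r fun j => algebraMap A B (c j)).eval β - (α - β) *
        (monicOfCoeffs r fun j => algebraMap A B (c j)).derivative.eval α = 0) :
    IsIntegral A α ∧ IsIntegral A β := by
  have h1' := derivativeDividedDiff_mul_sub (fun j => algebraMap A B (c j)) α β
  rw [h1, zero_mul] at h1'
  rw [derivativeDividedDiff] at h1
  simp only [eval_monicOfCoeffs, eval_derivative_monicOfCoeffs] at h1' h2
  have hnat : ∀ {k n : ℕ} {x : B}, x ∈ degreeFiltration A α β k →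
      (n : B) * x ∈ degreeFiltration A α β k := fun {k n x} hx => by
    rw [← nsmul_eq_mul]
    exact Submodule.smul_of_tower_mem _ _ hx
  have hsum : ∀ {k : ℕ} {x : Fin r → B}, (∀ j, x j ∈ degreeFiltration A α β k) →
      ∑ j, algebraMap A B (c j) * x j ∈ degreeFiltration A α β k := fun {k x} hx =>
    Submodule.sum_mem _ fun j _ => by
      rw [← Algebra.smul_def]
      exact Submodule.smul_mem _ _ (hx j)
  refine isIntegral_of_two_double_roots hr hr0 hr1 ?_ ?_ ?_
  · have := hsum (k := r - 2) (x := fun j => (j : ℕ) * (β ^ ((j : ℕ) - 1) - α ^ ((j : ℕ) - 1)))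
      fun j => hnat (Submodule.sub_mem _ (pow_right_mem_degreeFiltration (by omega))
        (pow_left_mem_degreeFiltration (by omega)))
    convert this using 1
    simp only [mul_sub, Finset.sum_sub_distrib]
    linear_combination -h1'
  · have := hsum (k := r - 3)
      (x := fun j => (j : ℕ) * ∑ i ∈ Finset.range (j - 1), α ^ i * β ^ ((j : ℕ) - 2 - i))
      fun j => hnat (Submodule.sum_mem _ fun i hi =>
        pow_mul_pow_mem_degreeFiltration (by have := Finset.mem_range.mp hi; omega))
    convert Submodule.neg_mem _ this using 1
    linear_combination h1
  · have := hsum (k := r - 1)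
      (x := fun j => α ^ (j : ℕ) - β ^ (j : ℕ) - (α - β) * ((j : ℕ) * α ^ ((j : ℕ) - 1)))
      fun j => by
        refine Submodule.sub_mem _ (Submodule.sub_mem _ (pow_left_mem_degreeFiltration (by omega))
          (pow_right_mem_degreeFiltration (by omega))) ?_
        rcases Nat.eq_zero_or_pos (j : ℕ) with hj | hj
        · simp [hj]
        rw [mul_left_comm]
        refine hnat (mul_mem_degreeFiltration (k := 1) (l := r - 2) (Submodule.sub_mem _ ?_ ?_)
          (pow_left_mem_degreeFiltration (by omega)) (by omega))
        · simpa using pow_left_mem_degreeFiltration (A := A) (α := α) (β := β) (i := 1) le_rfl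
        · simpa using pow_right_mem_degreeFiltration (A := A) (α := α) (β := β) (j := 1) le_rfl
    convert Submodule.neg_mem _ this using 1
    simp only [mul_sub, Finset.sum_sub_distrib, mul_left_comm _ (α - β), ← Finset.mul_sum]
    linear_combination h2

/-- The coefficient vector obtained from `c` by discarding the entries of index less than `l`. -/
def truncCoeffs (l : ℕ) (c : Fin r → R) (j : Fin r) : R :=
  if l ≤ (j : ℕ) then c j else 0

lemma map_truncCoeffs (g : R →+* R') (l : ℕ) (c : Fin r → R) (j : Fin r) :
    g (truncCoeffs l c j) = truncCoeffs l (fun j => g (c j)) j := by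
  rw [truncCoeffs, truncCoeffs, apply_ite g, map_zero]

lemma truncCoeffs_congr {l : ℕ} {c c' : Fin r → R} (h : ∀ j : Fin r, l ≤ (j : ℕ) → c j = c' j) :
    truncCoeffs l c = truncCoeffs l c' := by
  funext j
  rw [truncCoeffs, truncCoeffs]
  split_ifs with hj
  exacts [h j hj, rfl]

/-- The part of degree at least `l` of `monicOfCoeffs r c`. -/
noncomputable def tailPoly (l : ℕ) (c : Fin r → R) : Polynomial R :=
  monicOfCoeffs r (truncCoeffs l c)

lemma map_tailPoly (g : R →+* R') (l : ℕ) (c : Fin r → R) :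
    (tailPoly l c).map g = tailPoly l fun j => g (c j) := by
  simp only [tailPoly, map_monicOfCoeffs, map_truncCoeffs]

lemma tailPoly_zero (c : Fin r → R) : tailPoly 0 c = monicOfCoeffs r c := by
  simp only [tailPoly]
  congr 1

lemma tailPoly_eq (c : Fin r → R) {l : ℕ} (hl : l < r) :
    tailPoly l c = Polynomial.C (c ⟨l, hl⟩) * Polynomial.X ^ l + tailPoly (l + 1) c := by
  have : ∀ j : Fin r, truncCoeffs l c j = (if j = ⟨l, hl⟩ then c ⟨l, hl⟩ else 0) +
      truncCoeffs (l + 1) c j := fun j => by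
    by_cases hj : j = ⟨l, hl⟩
    · subst hj
      simp [truncCoeffs]
    · have : (j : ℕ) ≠ l := fun h => hj (Fin.ext h)
      simp only [truncCoeffs, hj, if_false, zero_add]
      congr 1
      simp only [eq_iff_iff]
      omega
  simp only [tailPoly, monicOfCoeffs, this, map_add, add_mul, Finset.sum_add_distrib]
  rw [Finset.sum_eq_single ⟨l, hl⟩ (by simp +contextual) (by simp)]
  simp only [if_true]
  ring

lemma tailPoly_of_eq_zero {c : Fin r → R} {l : ℕ} (h : ∀ j : Fin r, l ≤ (j : ℕ) → c j = 0) :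
    tailPoly l c = Polynomial.X ^ r := by
  have : truncCoeffs l c = 0 := by
    rw [truncCoeffs_congr (c' := 0) h]
    funext j
    simp [truncCoeffs]
  simp [tailPoly, monicOfCoeffs, this]

/-- The values of the coefficients for which `α` is a multiple root of `monicOfCoeffs r c`, in terms
of `α` and of the coefficients `c j` with `2 ≤ j`. -/
noncomputable def doubleRootCoeffs (c : Fin r → R) (α : R) (j : Fin r) : R :=
  if (j : ℕ) = 0 then α * (tailPoly 2 c).derivative.eval α - (tailPoly 2 c).eval α
  else if (j : ℕ) = 1 then - (tailPoly 2 c).derivative.eval α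
  else c j

lemma map_eval_tailPoly (g : R →+* R') (l : ℕ) (c : Fin r → R) (α : R) :
    g ((tailPoly l c).eval α) = (tailPoly l fun j => g (c j)).eval (g α) := by
  rw [← map_tailPoly, Polynomial.eval_map, Polynomial.eval₂_at_apply]

lemma map_eval_derivative_tailPoly (g : R →+* R') (l : ℕ) (c : Fin r → R) (α : R) :
    g ((tailPoly l c).derivative.eval α) =
      (tailPoly l fun j => g (c j)).derivative.eval (g α) := by
  rw [← map_tailPoly, Polynomial.derivative_map, Polynomial.eval_map, Polynomial.eval₂_at_apply]

lemma map_eval_derivative_derivative_tailPoly (g : R →+* R') (l : ℕ) (c : Fin r → R) (α : R) :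
    g ((tailPoly l c).derivative.derivative.eval α) =
      (tailPoly l fun j => g (c j)).derivative.derivative.eval (g α) := by
  rw [← map_tailPoly, Polynomial.derivative_map, Polynomial.derivative_map, Polynomial.eval_map,
    Polynomial.eval₂_at_apply]

lemma map_doubleRootCoeffs (g : R →+* R') (c : Fin r → R) (α : R) (j : Fin r) :
    g (doubleRootCoeffs c α j) = doubleRootCoeffs (fun j => g (c j)) (g α) j := by
  rw [doubleRootCoeffs, doubleRootCoeffs]
  split_ifs <;> simp [map_eval_tailPoly, map_eval_derivative_tailPoly]

lemma monicOfCoeffs_eq_add_tailPoly (hr : 2 ≤ r) (a : Fin r → R) :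
    monicOfCoeffs r a = Polynomial.C (a ⟨0, by omega⟩) +
      Polynomial.C (a ⟨1, by omega⟩) * Polynomial.X + tailPoly 2 a := by
  rw [← tailPoly_zero, tailPoly_eq a (show 0 < r by omega), tailPoly_eq a (show 0 + 1 < r by omega)]
  simp [add_assoc]

lemma eq_doubleRootCoeffs (hr : 2 ≤ r) {a c : Fin r → R} {α : R}
    (hac : ∀ j : Fin r, 2 ≤ (j : ℕ) → a j = c j) (h0 : (monicOfCoeffs r a).eval α = 0)
    (h1 : (monicOfCoeffs r a).derivative.eval α = 0) (j : Fin r) :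
    a j = doubleRootCoeffs c α j := by
  have ht : tailPoly 2 a = tailPoly 2 c := by rw [tailPoly, tailPoly, truncCoeffs_congr hac]
  rw [monicOfCoeffs_eq_add_tailPoly hr, ht] at h0 h1
  simp only [Polynomial.derivative_add, Polynomial.derivative_C, Polynomial.derivative_C_mul,
    Polynomial.derivative_X, Polynomial.eval_add, Polynomial.eval_mul, Polynomial.eval_C,
    Polynomial.eval_X, mul_one, zero_add] at h0 h1
  rw [doubleRootCoeffs]
  split_ifs with hj hj'
  · rw [show j = ⟨0, by omega⟩ from Fin.ext hj]
    linear_combination h0 - α * h1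
  · rw [show j = ⟨1, by omega⟩ from Fin.ext hj']
    linear_combination h1
  · exact hac j (by omega)

end MonicOfCoeffs

section MultipleRoots

variable {K : Type*} [Field K] {r : ℕ}

/-- `α` is a multiple root of the monic polynomial with coefficients `a`. -/
def IsMultipleRoot (a : Fin r → K) (α : K) : Prop :=
  (monicOfCoeffs r a).eval α = 0 ∧ (monicOfCoeffs r a).derivative.eval α = 0

lemma algDepOn_of_isMultipleRoot (hr : 2 ≤ r) {τ : Type*} {d : ℕ} {Z : Set (Fin r → K)}
    {Z' : Set (τ → K)} (h : AlgDepOn d Z') (c : Fin r → MvPolynomial τ K) (α : MvPolynomial τ K)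
    (hZ : ∀ a ∈ Z, ∃ x ∈ Z', (∀ j : Fin r, 2 ≤ (j : ℕ) → a j = MvPolynomial.eval x (c j)) ∧
      IsMultipleRoot a (MvPolynomial.eval x α)) : AlgDepOn d Z := by
  refine h.of_param (doubleRootCoeffs c α) fun a ha => ?_
  obtain ⟨x, hx, hc, h0, h1⟩ := hZ a ha
  refine ⟨x, hx, fun j => ?_⟩
  rw [map_doubleRootCoeffs]
  exact eq_doubleRootCoeffs hr hc h0 h1 j

variable {S : Type*} [Fintype S]

/-- The linear forms with coefficients `N` in the variables `X (e s)`. -/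
noncomputable def linForm {τ : Type*} (N : Fin r → S → K) (e : S → τ) (j : Fin r) :
    MvPolynomial τ K :=
  ∑ s, MvPolynomial.C (N j s) * MvPolynomial.X (e s)

lemma eval_linForm {τ : Type*} (N : Fin r → S → K) (e : S → τ) (j : Fin r) (x : τ → K) :
    MvPolynomial.eval x (linForm N e j) = ∑ s, N j s * x (e s) := by
  simp [linForm]

variable {N : Fin r → S → K} {ι : S → Fin r} {W : Set (Fin r → K)}

lemma algDepOn_multipleRoot (hr : 2 ≤ r)
    (hW : ∀ a ∈ W, ∀ j : Fin r, 2 ≤ (j : ℕ) → a j = ∑ s, N j s * a (ι s)) {d : ℕ}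
    (hd : Fintype.card S + 1 ≤ d) : AlgDepOn d {a | a ∈ W ∧ ∃ α, IsMultipleRoot a α} := by
  refine algDepOn_of_isMultipleRoot hr (algDepOn_univ (τ := Option S) (by simpa using hd) Set.univ)
    (linForm N some) (MvPolynomial.X none) ?_
  rintro a ⟨ha, α, hα⟩
  refine ⟨fun o => o.elim α fun s => a (ι s), trivial, fun j hj => ?_, by simpa using hα⟩
  rw [eval_linForm, hW a ha j hj]
  rfl

lemma algDepOn_multipleRoot_of_coeff_zero (hr : 2 ≤ r)
    (hW : ∀ a ∈ W, ∀ j : Fin r, 2 ≤ (j : ℕ) → a j = ∑ s, N j s * a (ι s)) {d : ℕ}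
    (hd : Fintype.card S ≤ d)
    (hne : ∃ (α : K) (b : S → K), α * (tailPoly 2 fun j => ∑ s, N j s * b s).derivative.eval α -
      (tailPoly 2 fun j => ∑ s, N j s * b s).eval α ≠ 0) :
    AlgDepOn d {a | a ∈ W ∧ a ⟨0, by omega⟩ = 0 ∧ ∃ α, IsMultipleRoot a α} := by
  have heval : ∀ x : Option S → K, MvPolynomial.eval x
      (doubleRootCoeffs (linForm N some) (MvPolynomial.X none) ⟨0, by omega⟩) =
      x none * (tailPoly 2 fun j => ∑ s, N j s * x (some s)).derivative.eval (x none) -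
        (tailPoly 2 fun j => ∑ s, N j s * x (some s)).eval (x none) := fun x => by
    rw [map_doubleRootCoeffs]
    simp [doubleRootCoeffs, eval_linForm]
  refine algDepOn_of_isMultipleRoot hr (algDepOn_of_hypersurface (τ := Option S)
    (by simpa using hd) (doubleRootCoeffs (linForm N some) (MvPolynomial.X none) ⟨0, by omega⟩)
    ?_ fun _ hx => hx) (linForm N some) (MvPolynomial.X none) ?_
  · obtain ⟨α, b, h⟩ := hne
    refine ⟨fun o => o.elim α b, ?_⟩
    rw [heval]
    exact h
  · rintro a ⟨ha, h0, α, hα⟩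
    have hc : ∀ j : Fin r, 2 ≤ (j : ℕ) → a j = ∑ s, N j s * a (ι s) := hW a ha
    refine ⟨fun o => o.elim α fun s => a (ι s), ?_, fun j hj => ?_, by simpa using hα⟩
    · have h := eq_doubleRootCoeffs hr hc hα.1 hα.2 ⟨0, by omega⟩
      rw [h0] at h
      change MvPolynomial.eval _ _ = 0
      rw [map_doubleRootCoeffs, h]
      simp [eval_linForm]
    · rw [eval_linForm, hc j hj]
      rfl

lemma algDepOn_tripleRoot (hr : 2 ≤ r)
    (hW : ∀ a ∈ W, ∀ j : Fin r, 2 ≤ (j : ℕ) → a j = ∑ s, N j s * a (ι s)) {d : ℕ}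
    (hd : Fintype.card S ≤ d)
    (hne : ∃ (α : K) (b : S → K),
      (tailPoly 2 fun j => ∑ s, N j s * b s).derivative.derivative.eval α ≠ 0) :
    AlgDepOn d {a | a ∈ W ∧ ∃ α, IsMultipleRoot a α ∧
      (monicOfCoeffs r a).derivative.derivative.eval α = 0} := by
  have heval : ∀ x : Option S → K, MvPolynomial.eval x
      ((tailPoly 2 (linForm N some)).derivative.derivative.eval (MvPolynomial.X none)) =
      (tailPoly 2 fun j => ∑ s, N j s * x (some s)).derivative.derivative.eval (x none) :=
    fun x => by
      rw [map_eval_derivative_derivative_tailPoly]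
      simp [eval_linForm]
  refine algDepOn_of_isMultipleRoot hr (algDepOn_of_hypersurface (τ := Option S)
    (by simpa using hd) _ ?_ fun x (hx : MvPolynomial.eval x
      ((tailPoly 2 (linForm N some)).derivative.derivative.eval (MvPolynomial.X none)) = 0) => hx)
    (linForm N some) (MvPolynomial.X none) ?_
  · obtain ⟨α, b, h⟩ := hne
    refine ⟨fun o => o.elim α b, ?_⟩
    rw [heval]
    exact h
  · rintro a ⟨ha, α, hα, h2⟩
    have hc : ∀ j : Fin r, 2 ≤ (j : ℕ) → a j = ∑ s, N j s * a (ι s) := hW a ha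
    refine ⟨fun o => o.elim α fun s => a (ι s), ?_, fun j hj => ?_, by simpa using hα⟩
    · change MvPolynomial.eval _ _ = 0
      rw [heval]
      rw [monicOfCoeffs_eq_add_tailPoly hr, tailPoly, truncCoeffs_congr hc] at h2
      simpa [tailPoly] using h2
    · rw [eval_linForm, hc j hj]
      rfl

/-- Polynomials with two distinct multiple roots, when the coefficient of `X ^ 2` is free. -/
lemma algDepOn_two_multipleRoots_of_three (hr : 3 ≤ r) (h2 : (2 : K) ≠ 0)
    (hW : ∀ a ∈ W, ∀ j : Fin r, 3 ≤ (j : ℕ) → a j = ∑ s, N j s * a (ι s)) {d : ℕ}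
    (hd : Fintype.card S + 1 ≤ d)
    (hne : ∃ α β : K, 2 * (α ^ r - β ^ r) - (α - β) * (r * (α ^ (r - 1) + β ^ (r - 1))) ≠ 0) :
    AlgDepOn d {a | a ∈ W ∧ ∃ α β, α ≠ β ∧ IsMultipleRoot a α ∧ IsMultipleRoot a β} := by
  let τ := Option (Option S)
  let α : MvPolynomial τ K := MvPolynomial.X none
  let β : MvPolynomial τ K := MvPolynomial.X (some none)
  let e : S → τ := fun s => some (some s)
  let t := tailPoly 3 (linForm N e)
  obtain ⟨z, hz⟩ := t.derivative.evalSubFactor α β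
  let E := 2 * (t.eval α - t.eval β) - (α - β) * (t.derivative.eval α + t.derivative.eval β)
  have hE : ∀ x : τ → K, MvPolynomial.eval x E =
      2 * ((tailPoly 3 fun j => ∑ s, N j s * x (e s)).eval (x none) -
        (tailPoly 3 fun j => ∑ s, N j s * x (e s)).eval (x (some none))) -
      (x none - x (some none)) *
        ((tailPoly 3 fun j => ∑ s, N j s * x (e s)).derivative.eval (x none) +
        (tailPoly 3 fun j => ∑ s, N j s * x (e s)).derivative.eval (x (some none))) := fun x => by
    simp [E, t, α, β, map_eval_tailPoly, map_eval_derivative_tailPoly, eval_linForm]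
  have hz' : ∀ x : τ → K,
      (tailPoly 3 fun j => ∑ s, N j s * x (e s)).derivative.eval (x none) -
        (tailPoly 3 fun j => ∑ s, N j s * x (e s)).derivative.eval (x (some none)) =
      MvPolynomial.eval x z * (x none - x (some none)) := fun x => by
    have := congrArg (MvPolynomial.eval x) hz
    simpa [t, α, β, map_eval_tailPoly, map_eval_derivative_tailPoly, eval_linForm] using this
  refine algDepOn_of_isMultipleRoot (by omega) (algDepOn_of_hypersurface (τ := τ)
    (by simpa [τ] using hd) E ?_ fun _ hx => hx)
    (fun j => if (j : ℕ) = 2 then MvPolynomial.C (-2⁻¹) * z else linForm N e j) α ?_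
  · obtain ⟨u, v, h⟩ := hne
    refine ⟨fun o => o.elim u fun o => o.elim v 0, ?_⟩
    rw [hE, tailPoly_of_eq_zero]
    · simpa [Polynomial.derivative_X_pow, mul_add] using h
    · simp [e]
  · rintro a ⟨ha, u, v, huv, ⟨hu0, hu1⟩, hv0, hv1⟩
    let x : τ → K := fun o => o.elim u fun o => o.elim v fun s => a (ι s)
    have hc : ∀ j : Fin r, 3 ≤ (j : ℕ) → a j = ∑ s, N j s * x (e s) := hW a ha
    have hα : MvPolynomial.eval x α = u := by simp [α, x]
    have hxu : x none = u := rfl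
    have hxv : x (some none) = v := rfl
    have hzx := hz' x
    rw [hxu, hxv] at hzx
    have ht : monicOfCoeffs r a = Polynomial.C (a ⟨0, by omega⟩) +
        Polynomial.C (a ⟨1, by omega⟩) * Polynomial.X +
        (Polynomial.C (a ⟨2, hr⟩) * Polynomial.X ^ 2 +
          tailPoly 3 fun j => ∑ s, N j s * x (e s)) := by
      rw [monicOfCoeffs_eq_add_tailPoly (by omega), tailPoly_eq a hr]
      congr 2
      rw [tailPoly, truncCoeffs_congr hc, tailPoly]
    refine ⟨x, ?_, fun j hj => ?_, by rw [hα]; exact ⟨hu0, hu1⟩⟩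
    · change MvPolynomial.eval x E = 0
      rw [hE, hxu, hxv]
      rw [ht] at hu0 hv0 hu1 hv1
      simp at hu0 hv0 hu1 hv1
      linear_combination 2 * (hu0 - hv0) - (u - v) * (hu1 + hv1)
    · split_ifs with hj2
      · rw [show j = ⟨2, hr⟩ from Fin.ext hj2]
        rw [ht] at hu1 hv1
        simp at hu1 hv1
        have : (u - v) * (a ⟨2, hr⟩ + 2⁻¹ * MvPolynomial.eval x z) = 0 := by
          field_simp
          linear_combination hu1 - hv1 - hzx
        have := (mul_eq_zero.mp this).resolve_left (sub_ne_zero.mpr huv)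
        rw [map_mul, MvPolynomial.eval_C]
        linear_combination this
      · rw [eval_linForm, hc j (by omega)]

/-- Polynomials with two distinct multiple roots, when the degree is prime to the
characteristic. -/
lemma algDepOn_two_multipleRoots (hr : 3 ≤ r) (hr0 : (r : K) ≠ 0) (hr1 : (r : K) - 1 ≠ 0)
    (hW : ∀ a ∈ W, ∀ j : Fin r, 2 ≤ (j : ℕ) → a j = ∑ s, N j s * a (ι s)) {d : ℕ}
    (hd : Fintype.card S ≤ d) :
    AlgDepOn d {a | a ∈ W ∧ ∃ α β, α ≠ β ∧ IsMultipleRoot a α ∧ IsMultipleRoot a β} := by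
  let τ := Option (Option S)
  let α : MvPolynomial τ K := MvPolynomial.X none
  let β : MvPolynomial τ K := MvPolynomial.X (some none)
  let e : S → τ := fun s => some (some s)
  let t := tailPoly 2 (linForm N e)
  let D₁ := derivativeDividedDiff (truncCoeffs 2 (linForm N e)) α β
  let D₂ := t.eval α - t.eval β - (α - β) * t.derivative.eval α
  let J : Ideal (MvPolynomial τ K) := Ideal.span {D₁, D₂}
  have hdep : AlgDepOn d {x | MvPolynomial.eval x D₁ = 0 ∧ MvPolynomial.eval x D₂ = 0} := by
    refine algDepOn_of_not_algebraicIndependent J ?_ ?_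
    · rintro x ⟨h₁, h₂⟩ p hp
      have : J ≤ RingHom.ker (MvPolynomial.eval x) := by
        refine Ideal.span_le.mpr ?_
        rintro _ (rfl | rfl)
        exacts [h₁, h₂]
      exact this hp
    · let f : MvPolynomial S K →ₐ[K] MvPolynomial τ K ⧸ J :=
        (Ideal.Quotient.mkₐ K J).comp (MvPolynomial.rename e)
      refine not_algebraicIndependent_of_isIntegral f ?_ hd
      let := f.toRingHom.toAlgebra
      have hunit : ∀ {x : K}, x ≠ 0 → IsUnit (MvPolynomial.C x : MvPolynomial S K) := fun hx =>
        (isUnit_iff_ne_zero.mpr hx).map MvPolynomial.C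
      have hf : ∀ j, algebraMap (MvPolynomial S K) (MvPolynomial τ K ⧸ J)
          (truncCoeffs 2 (linForm N id) j) =
          Ideal.Quotient.mk J (truncCoeffs 2 (linForm N e) j) := fun j => by
        rw [map_truncCoeffs, map_truncCoeffs]
        congr 1
        funext j
        change Ideal.Quotient.mk J (MvPolynomial.rename e (linForm N id j)) = _
        simp [linForm]
      have hmem : ∀ {p}, p ∈ J → Ideal.Quotient.mk J p = 0 := Ideal.Quotient.eq_zero_iff_mem.mpr
      obtain ⟨hα, hβ⟩ := isIntegral_of_derivativeDividedDiff_eq_zero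
        (A := MvPolynomial S K) (B := MvPolynomial τ K ⧸ J)
        (α := Ideal.Quotient.mk J α) (β := Ideal.Quotient.mk J β) hr
        (by simpa using hunit hr0) (by simpa using hunit hr1) (truncCoeffs 2 (linForm N id))
        (by
          simp only [hf]
          rw [← map_derivativeDividedDiff]
          exact hmem (Ideal.subset_span (by simp [D₁])))
        (by
          simp only [hf]
          rw [← map_monicOfCoeffs, Polynomial.derivative_map, Polynomial.eval_map,
            Polynomial.eval_map, Polynomial.eval_map, Polynomial.eval₂_at_apply,
            Polynomial.eval₂_at_apply, Polynomial.eval₂_at_apply, ← map_sub, ← map_sub, ← map_mul,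
            ← map_sub]
          exact hmem (Ideal.subset_span (by simp [D₂, t, tailPoly])))
      intro b
      obtain ⟨p, rfl⟩ := Ideal.Quotient.mk_surjective b
      change IsIntegral (MvPolynomial S K) _
      induction p using MvPolynomial.induction_on with
      | C x =>
        have : Ideal.Quotient.mk J (MvPolynomial.C x) =
            algebraMap (MvPolynomial S K) _ (MvPolynomial.C x) := by
          change _ = Ideal.Quotient.mk J (MvPolynomial.rename e (MvPolynomial.C x))
          rw [MvPolynomial.rename_C]
        rw [this]
        exact isIntegral_algebraMap
      | add p q hp hq => exact hp.add hq
      | mul_X p i hp =>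
        rw [map_mul]
        refine hp.mul ?_
        rcases i with _ | _ | s
        · exact hα
        · exact hβ
        · have : Ideal.Quotient.mk J (MvPolynomial.X (some (some s))) =
              algebraMap (MvPolynomial S K) _ (MvPolynomial.X s) := by
            change _ = Ideal.Quotient.mk J (MvPolynomial.rename e (MvPolynomial.X s))
            rw [MvPolynomial.rename_X]
          rw [this]
          exact isIntegral_algebraMap
  refine algDepOn_of_isMultipleRoot (by omega) hdep (linForm N e) α ?_
  rintro a ⟨ha, u, v, huv, ⟨hu0, hu1⟩, hv0, hv1⟩
  let x : τ → K := fun o => o.elim u fun o => o.elim v fun s => a (ι s)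
  have hc : ∀ j : Fin r, 2 ≤ (j : ℕ) → a j = ∑ s, N j s * x (e s) := hW a ha
  have hα : MvPolynomial.eval x α = u := by simp [α, x]
  have hβ : MvPolynomial.eval x β = v := by simp [β, x]
  have ht := monicOfCoeffs_eq_add_tailPoly (show 2 ≤ r by omega) a
  rw [show tailPoly 2 a = tailPoly 2 fun j => ∑ s, N j s * x (e s) by
    rw [tailPoly, truncCoeffs_congr hc, tailPoly]] at ht
  refine ⟨x, ⟨?_, ?_⟩, fun j hj => by rw [eval_linForm, hc j hj],
    by rw [hα]; exact ⟨hu0, hu1⟩⟩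
  · refine (mul_eq_zero.mp ?_).resolve_right (sub_ne_zero.mpr huv)
    rw [map_derivativeDividedDiff, hα, hβ, derivativeDividedDiff_mul_sub]
    rw [ht] at hu1 hv1
    simp only [map_truncCoeffs, eval_linForm]
    simp [tailPoly] at hu1 hv1
    linear_combination hu1 - hv1
  · rw [ht] at hu0 hv0 hu1
    simp at hu0 hv0 hu1
    simp only [D₂, t, map_sub, map_mul, map_eval_tailPoly, map_eval_derivative_tailPoly, hα, hβ,
      eval_linForm]
    linear_combination hu0 - hv0 - (u - v) * hu1

end MultipleRoots

section AlgClosed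

variable {K : Type*} [Field K] {r : ℕ}

lemma monic_monicOfCoeffs (a : Fin r → K) : (monicOfCoeffs r a).Monic := by
  refine Polynomial.monic_X_pow_add ?_
  refine (Polynomial.degree_sum_le _ _).trans_lt ((Finset.sup_lt_iff (WithBot.bot_lt_coe r)).mpr ?_)
  intro j _
  exact (Polynomial.degree_C_mul_X_pow_le _ _).trans_lt (Nat.cast_lt.mpr j.2)

variable [IsAlgClosed K]

lemma exists_isMultipleRoot_of_not_squarefree {a : Fin r → K}
    (h : ¬ Squarefree (monicOfCoeffs r a)) : ∃ α, IsMultipleRoot a α := by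
  rw [Squarefree] at h
  push Not at h
  obtain ⟨p, ⟨q, hq⟩, hp⟩ := h
  have hp0 : p ≠ 0 := by
    rintro rfl
    exact (monic_monicOfCoeffs a).ne_zero (by simpa using hq)
  obtain ⟨α, hα⟩ := IsAlgClosed.exists_root p fun hdeg =>
    hp (Polynomial.isUnit_iff_degree_eq_zero.mpr hdeg)
  rw [Polynomial.IsRoot] at hα
  refine ⟨α, ?_, ?_⟩ <;> rw [hq] <;> simp [Polynomial.derivative_mul, hα]

lemma exists_isMultipleRoot_of_two_le_degree_gcd {a : Fin r → K}
    (h : 2 ≤ (EuclideanDomain.gcd (monicOfCoeffs r a)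
      (Polynomial.derivative (monicOfCoeffs r a))).degree) :
    (∃ α, IsMultipleRoot a α ∧ (monicOfCoeffs r a).derivative.derivative.eval α = 0) ∨
      ∃ α β, α ≠ β ∧ IsMultipleRoot a α ∧ IsMultipleRoot a β := by
  set f := monicOfCoeffs r a with hf
  obtain ⟨u, hu⟩ := EuclideanDomain.gcd_dvd_left f f.derivative
  obtain ⟨v, hv⟩ := EuclideanDomain.gcd_dvd_right f f.derivative
  set g := EuclideanDomain.gcd f f.derivative
  have hroot : ∀ {α}, g.eval α = 0 → IsMultipleRoot a α := fun {α} hα => by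
    refine ⟨?_, ?_⟩
    · rw [← hf, hu, Polynomial.eval_mul, hα, zero_mul]
    · rw [← hf, hv, Polynomial.eval_mul, hα, zero_mul]
  obtain ⟨α, hα⟩ := IsAlgClosed.exists_root g fun h0 => by
    rw [h0] at h
    exact absurd h (by decide)
  obtain ⟨g₁, hg₁⟩ := Polynomial.dvd_iff_isRoot.mpr hα
  obtain ⟨β, hβ⟩ := IsAlgClosed.exists_root g₁ fun h0 => by
    rw [hg₁, Polynomial.degree_mul, Polynomial.degree_X_sub_C, h0] at h
    exact absurd h (by decide)
  rw [Polynomial.IsRoot] at hα hβ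
  by_cases hαβ : α = β
  · subst hαβ
    refine Or.inl ⟨α, hroot hα, ?_⟩
    rw [hv, hg₁]
    simp [Polynomial.derivative_mul, hβ]
  · refine Or.inr ⟨α, β, hαβ, hroot hα, hroot ?_⟩
    rw [hg₁, Polynomial.eval_mul, hβ, mul_zero]

lemma exists_pairing_ne_zero (hr : 4 ≤ r) (h2 : (2 : K) ≠ 0) :
    ∃ α β : K, 2 * (α ^ r - β ^ r) - (α - β) * (r * (α ^ (r - 1) + β ^ (r - 1))) ≠ 0 := by
  by_cases hrK : (r : K) = 2
  · obtain ⟨α, hα⟩ : ∃ α : K, α ^ (r - 1) - α ≠ 0 := by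
      by_contra! h
      have : (Polynomial.X ^ (r - 1) - Polynomial.X : Polynomial K) = 0 :=
        Polynomial.funext fun α => by simpa using h α
      have := congrArg Polynomial.degree (sub_eq_zero.mp this)
      rw [Polynomial.degree_X_pow, Polynomial.degree_X] at this
      have : r - 1 = 1 := by exact_mod_cast this
      omega
    refine ⟨α, 1, ?_⟩
    obtain ⟨s, rfl⟩ := Nat.exists_eq_add_of_le' (show 1 ≤ r by omega)
    rw [hrK]
    convert mul_ne_zero h2 hα using 1
    simp only [Nat.add_sub_cancel, one_pow]
    ring
  · refine ⟨1, 0, ?_⟩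
    rw [zero_pow (by omega), zero_pow (by omega)]
    simpa [sub_eq_zero] using Ne.symm hrK

end AlgClosed

section EchelonParametrization

variable {F K : Type*} [Field F] [Field K] [Algebra F K] {r m : ℕ} {k : Fin r}
  {L : Fin m → MvPolynomial {j : Fin r // j ≠ k} F} {piv : Fin m → {j : Fin r // j ≠ k}}

lemma card_nonpivots_add_le {l : ℕ} (hinj : Function.Injective piv)
    (hpiv : ∀ t, l ≤ ((piv t).1 : ℕ)) :
    Fintype.card {v : {j : Fin r // j ≠ k} // l ≤ (v.1 : ℕ) ∧ v ∉ Set.range piv} + m ≤ r - l := by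
  let φ : {v : {j : Fin r // j ≠ k} // l ≤ (v.1 : ℕ) ∧ v ∉ Set.range piv} ⊕ Fin m → Fin (r - l) :=
    Sum.elim (fun s => ⟨(s.1.1 : ℕ) - l, by have := s.2.1; omega⟩)
      fun t => ⟨((piv t).1 : ℕ) - l, by have := hpiv t; omega⟩
  have hφ : Function.Injective φ := by
    rintro (s | t) (s' | t') h <;>
      simp only [φ, Sum.elim_inl, Sum.elim_inr, Fin.mk.injEq] at h
    · have h1 := s.2.1
      have h2 := s'.2.1
      exact congrArg Sum.inl (Subtype.ext (Subtype.ext (Fin.ext (by omega))))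
    · have h1 := s.2.1
      have h2 := hpiv t'
      exact absurd ⟨t', Subtype.ext (Fin.ext (by omega))⟩ s.2.2
    · have h1 := s'.2.1
      have h2 := hpiv t
      exact absurd ⟨t, Subtype.ext (Fin.ext (by omega))⟩ s'.2.2
    · have h1 := hpiv t
      have h2 := hpiv t'
      exact congrArg Sum.inr (hinj (Subtype.ext (Fin.ext (by omega))))
  simpa using Fintype.card_le_of_injective φ hφ

lemma IsEchelonFamily.exists_coeffs (h : IsEchelonFamily L piv) (hk : (k : ℕ) = 0) {l : ℕ}
    (hl : 1 ≤ l) :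
    ∃ N : Fin r → {v : {j : Fin r // j ≠ k} // l ≤ (v.1 : ℕ) ∧ v ∉ Set.range piv} → K,
      (∀ (j : Fin r) s, (s.1.1 : ℕ) < j → N j s = 0) ∧ (∀ s, N s.1.1 s = 1) ∧
      ∀ a : Fin r → K, (∀ t, MvPolynomial.eval (fun j : {j : Fin r // j ≠ k} => a j.1)
        (MvPolynomial.map (algebraMap F K) (L t)) = 0) →
        ∀ j : Fin r, l ≤ (j : ℕ) → a j = ∑ s, N j s * a s.1.1 := by
  obtain ⟨N, hN₁, hN₂, hN⟩ := h.exists_parametrization (K := K)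
  refine ⟨fun j s => if hj : j ≠ k then algebraMap F K (N ⟨j, hj⟩ s.1) else 0, ?_, ?_, ?_⟩
  · intro j s hs
    dsimp only
    split_ifs with hj
    · rw [hN₁ ⟨j, hj⟩ s.1 hs, map_zero]
    · rfl
  · intro s
    dsimp only
    rw [dif_pos s.1.2, hN₂ _ s.2.2, if_pos rfl, map_one]
  · intro a ha j hj
    have hjk : j ≠ k := by
      rintro rfl
      omega
    rw [hN (fun j => a j.1) ha ⟨j, hjk⟩]
    simp only [dif_pos hjk]
    rw [← Finset.sum_subtype (p := fun v : {j : Fin r // j ≠ k} =>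
        l ≤ (v.1 : ℕ) ∧ v ∉ Set.range piv) (Finset.univ.filter fun v =>
        l ≤ (v.1 : ℕ) ∧ v ∉ Set.range piv) (by simp)
        (fun s => algebraMap F K (N ⟨j, hjk⟩ s) * a s.1), Finset.sum_filter]
    refine Finset.sum_congr rfl fun s _ => ?_
    by_cases hs : s ∈ Set.range piv
    · simp [hs]
    · by_cases hls : l ≤ (s.1 : ℕ)
      · simp [hs, hls]
      · have : s < ⟨j, hjk⟩ := by
          change (s.1 : ℕ) < j
          omega
        simp [hls, hN₁ _ _ this]

variable [IsAlgClosed K]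

lemma IsEchelonFamily.algDepOn_not_squarefree (h : IsEchelonFamily L piv) (hk : (k : ℕ) = 0)
    (hpiv : ∀ t, 2 ≤ ((piv t).1 : ℕ)) (hm : m + 2 ≤ r) :
    AlgDepOn (r - m - 1) {a : Fin r → K |
      (∀ t, MvPolynomial.eval (fun j : {j : Fin r // j ≠ k} => a j.1)
        (MvPolynomial.map (algebraMap F K) (L t)) = 0) ∧ ¬ Squarefree (monicOfCoeffs r a)} := by
  obtain ⟨N, -, -, hN⟩ := h.exists_coeffs (K := K) hk one_le_two
  have hcard := card_nonpivots_add_le h.injective hpiv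
  exact (algDepOn_multipleRoot (by omega) hN (by omega)).mono fun a ⟨ha, hsq⟩ =>
    ⟨ha, exists_isMultipleRoot_of_not_squarefree hsq⟩

lemma algDepOn_deeply_degenerate {W : Set (Fin r → K)} {d : ℕ} (hr : 2 ≤ r)
    (h₁ : AlgDepOn d {a | a ∈ W ∧ a ⟨0, by omega⟩ = 0 ∧ ∃ α, IsMultipleRoot a α})
    (h₂ : AlgDepOn d {a | a ∈ W ∧ ∃ α, IsMultipleRoot a α ∧
      (monicOfCoeffs r a).derivative.derivative.eval α = 0})
    (h₃ : AlgDepOn d {a | a ∈ W ∧ ∃ α β, α ≠ β ∧ IsMultipleRoot a α ∧ IsMultipleRoot a β}) :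
    AlgDepOn d ({a | a ∈ W ∧ ¬ Squarefree (monicOfCoeffs r a) ∧ a ⟨0, by omega⟩ = 0} ∪
      {a | a ∈ W ∧ 2 ≤ (EuclideanDomain.gcd (monicOfCoeffs r a)
        (Polynomial.derivative (monicOfCoeffs r a))).degree}) := by
  refine (h₁.union (h₂.union h₃)).mono ?_
  rintro a (⟨ha, hsq, h0⟩ | ⟨ha, hgcd⟩)
  · exact Or.inl ⟨ha, h0, exists_isMultipleRoot_of_not_squarefree hsq⟩
  · exact Or.inr ((exists_isMultipleRoot_of_two_le_degree_gcd hgcd).imp (⟨ha, ·⟩) (⟨ha, ·⟩))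

lemma IsEchelonFamily.algDepOn_deeply_degenerate_of_three (h : IsEchelonFamily L piv)
    (hk : (k : ℕ) = 0) (h2 : (2 : K) ≠ 0) (hpiv : ∀ t, 3 ≤ ((piv t).1 : ℕ)) (hm₁ : 1 ≤ m)
    (hm : m + 3 ≤ r) {W : Set (Fin r → K)}
    (hW : ∀ a ∈ W, ∀ t, MvPolynomial.eval (fun j : {j : Fin r // j ≠ k} => a j.1)
      (MvPolynomial.map (algebraMap F K) (L t)) = 0) :
    AlgDepOn (r - m - 2)
      ({a | a ∈ W ∧ ¬ Squarefree (monicOfCoeffs r a) ∧ a ⟨0, by omega⟩ = 0} ∪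
      {a | a ∈ W ∧ 2 ≤ (EuclideanDomain.gcd (monicOfCoeffs r a)
        (Polynomial.derivative (monicOfCoeffs r a))).degree}) := by
  have hpiv₂ : ∀ t, 2 ≤ ((piv t).1 : ℕ) := fun t => (Nat.le_succ 2).trans (hpiv t)
  have hcard₂ := card_nonpivots_add_le h.injective hpiv₂
  have hcard₃ := card_nonpivots_add_le h.injective hpiv
  obtain ⟨N, hN₀, hN₁, hN⟩ := h.exists_coeffs (K := K) hk one_le_two
  obtain ⟨N', -, -, hN'⟩ := h.exists_coeffs (K := K) hk (l := 3) (by omega)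
  let s₀ : {v : {j : Fin r // j ≠ k} // 2 ≤ (v.1 : ℕ) ∧ v ∉ Set.range piv} :=
    ⟨⟨⟨2, by omega⟩, fun hk' => by simp [← hk'] at hk⟩, le_rfl, by
      rintro ⟨t, ht⟩
      have := hpiv t
      rw [ht] at this
      simp at this⟩
  have htail : ∀ x : K, (tailPoly 2 fun j => ∑ s, N j s * (Pi.single s₀ x : _ → K) s) =
      Polynomial.C x * Polynomial.X ^ 2 + Polynomial.X ^ r := by
    intro x
    rw [tailPoly_eq _ (show 2 < r by omega), tailPoly_of_eq_zero]
    · simp [Pi.single_apply, show N ⟨2, by omega⟩ s₀ = 1 from hN₁ s₀]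
    · intro j hj
      simp [Pi.single_apply, hN₀ j s₀ (show 2 < (j : ℕ) by omega)]
  refine algDepOn_deeply_degenerate (by omega)
    (algDepOn_multipleRoot_of_coeff_zero (by omega) (fun a ha => hN a (hW a ha)) (by omega) ?_)
    (algDepOn_tripleRoot (by omega) (fun a ha => hN a (hW a ha)) (by omega) ?_)
    (algDepOn_two_multipleRoots_of_three (by omega) h2 (fun a ha => hN' a (hW a ha)) (by omega)
      (exists_pairing_ne_zero (by omega) h2))
  · refine ⟨1, Pi.single s₀ (2 - r), ?_⟩
    rw [htail]
    convert one_ne_zero (α := K) using 1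
    simp [Polynomial.derivative_X_pow]
    ring
  · refine ⟨1, Pi.single s₀ ((1 - r * (r - 1 : ℕ)) / 2), ?_⟩
    rw [htail]
    convert one_ne_zero (α := K) using 1
    simp [Polynomial.derivative_X_pow]
    field_simp
    ring

lemma IsEchelonFamily.algDepOn_deeply_degenerate (h : IsEchelonFamily L piv)
    (hk : (k : ℕ) = 0) (hr0 : (r : K) ≠ 0) (hr1 : (r : K) - 1 ≠ 0)
    (hpiv : ∀ t, 2 ≤ ((piv t).1 : ℕ)) (hm₁ : 1 ≤ m)
    (hm : m + 2 ≤ r) {W : Set (Fin r → K)}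
    (hW : ∀ a ∈ W, ∀ t, MvPolynomial.eval (fun j : {j : Fin r // j ≠ k} => a j.1)
      (MvPolynomial.map (algebraMap F K) (L t)) = 0) :
    AlgDepOn (r - m - 2)
      ({a | a ∈ W ∧ ¬ Squarefree (monicOfCoeffs r a) ∧ a ⟨0, by omega⟩ = 0} ∪
      {a | a ∈ W ∧ 2 ≤ (EuclideanDomain.gcd (monicOfCoeffs r a)
        (Polynomial.derivative (monicOfCoeffs r a))).degree}) := by
  have hcard := card_nonpivots_add_le h.injective hpiv
  obtain ⟨N, -, -, hN⟩ := h.exists_coeffs (K := K) hk one_le_two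
  have htail : (tailPoly 2 fun j => ∑ s, N j s * (0 : {v : {j : Fin r // j ≠ k} //
      2 ≤ (v.1 : ℕ) ∧ v ∉ Set.range piv} → K) s) = Polynomial.X ^ r :=
    tailPoly_of_eq_zero fun j _ => by simp
  refine _root_.algDepOn_deeply_degenerate (by omega)
    (algDepOn_multipleRoot_of_coeff_zero (by omega) (fun a ha => hN a (hW a ha)) (by omega) ?_)
    (algDepOn_tripleRoot (by omega) (fun a ha => hN a (hW a ha)) (by omega) ?_)
    (algDepOn_two_multipleRoots (by omega) hr0 hr1 (fun a ha => hN a (hW a ha)) (by omega))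
  · refine ⟨1, 0, ?_⟩
    rw [htail]
    simpa [Polynomial.derivative_X_pow] using hr1
  · refine ⟨1, 0, ?_⟩
    rw [htail]
    have : ((r - 1 : ℕ) : K) = r - 1 := by
      rw [Nat.cast_sub (by omega), Nat.cast_one]
    simp [Polynomial.derivative_X_pow, this, hr0, hr1]

end EchelonParametrization

section Weighted

variable {σ F : Type*} [Field F] [LinearOrder σ] {m : ℕ} {L : Fin m → MvPolynomial σ F}
  {piv : Fin m → σ}

/-- The components of highest weight of an echelon family form an echelon family with the same
pivots, provided the weights are decreasing. -/
lemma IsEchelonFamily.weightedHomogeneousComponent (h : IsEchelonFamily L piv) {w : σ → ℕ}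
    (hw : Antitone w) :
    IsEchelonFamily (fun t => MvPolynomial.weightedHomogeneousComponent w
      (MvPolynomial.weightedTotalDegree w (L t)) (L t)) piv := by
  have hdeg : ∀ t, MvPolynomial.weightedTotalDegree w (L t) = w (piv t) := by
    intro t
    refine le_antisymm (Finset.sup_le fun d hd => ?_) ?_
    · have hd1 := h.isHomogeneous t (MvPolynomial.mem_support_iff.mp hd)
      obtain ⟨v, rfl⟩ := (Finsupp.range_single_one (σ := σ)).symm.subset
        ((DFunLike.congr_fun Finsupp.degree_eq_weight_one d).trans hd1)
      simpa [Finsupp.weight_single] using hw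
        (h.le_of_coeff_ne_zero t v (MvPolynomial.mem_support_iff.mp hd))
    · simpa [Finsupp.weight_single] using MvPolynomial.le_weightedTotalDegree w
        (MvPolynomial.mem_support_iff.mpr (h.coeff_piv_ne_zero t))
  refine ⟨h.injective, fun t d hd => ?_, fun t v hv => ?_, fun t => ?_⟩
  · rw [MvPolynomial.coeff_weightedHomogeneousComponent] at hd
    exact h.isHomogeneous t fun h0 => hd (by rw [h0, ite_self])
  · rw [MvPolynomial.coeff_weightedHomogeneousComponent] at hv
    refine h.le_of_coeff_ne_zero t v fun h0 => hv (by rw [h0, ite_self])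
  · rw [MvPolynomial.coeff_weightedHomogeneousComponent,
      if_pos (by simp [hdeg, Finsupp.weight_single])]
    exact h.coeff_piv_ne_zero t

end Weighted

/-- Suppose `char F_q > 3`.  Linearly independent linear forms `L_1, …, L_m` in the
variables `A_{r-1}, …, A_n` in lower-triangular row echelon form (with pivot positions
`1 ≤ i_1 < ⋯ < i_m ≤ r - n`, the pivot of `L_j` being the variable `A_{r-i_j}`) satisfy
hypotheses (H1)–(H6) (with `k = 0`), provided either `n = 2` and `char F_q` does not divide
`r(r-1)`, or `n ≥ 3`. -/
theorem linear_families_satisfy_hypotheses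
    (Fq K : Type) [Field Fq] [Fintype Fq] [Field K] [Algebra Fq K] [IsAlgClosure Fq K]
    (hchar : 3 < ringChar Fq)
    (r m n : ℕ) (hm : 1 ≤ m) (hn2 : 2 ≤ n) (hnr : n ≤ r - m) (hmr : m < r)
    (k : Fin r) (hk : (k : ℕ) = 0)
    -- the linear forms `L_1, …, L_m` and their pivot positions `i_1 < ⋯ < i_m`
    (L : Fin m → MvPolynomial {j : Fin r // j ≠ k} Fq)
    (hhom : ∀ t, MvPolynomial.IsHomogeneous (L t) 1)
    (idx : Fin m → ℕ) (hmono : StrictMono idx)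
    (hidx1 : ∀ t, 1 ≤ idx t) (hidxup : ∀ t, idx t ≤ r - n)
    -- `L_t` only involves the variables `A_{r - i_t}, …, A_{r-1}`
    (hvars : ∀ t, ∀ d ∈ (L t).support, ∀ v ∈ d.support, r - idx t ≤ (v.1 : ℕ))
    -- the coefficient of the pivot variable `A_{r - i_t}` in `L_t` is nonzero
    (hpivot : ∀ t, ∃ v : {j : Fin r // j ≠ k}, (v.1 : ℕ) = r - idx t
        ∧ MvPolynomial.coeff (Finsupp.single v 1) (L t) ≠ 0)
    -- either `n = 2` and `char F_q` does not divide `r(r-1)`, or `n ≥ 3`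
    (hcase : (n = 2 ∧ ¬ (ringChar Fq : ℕ) ∣ r * (r - 1)) ∨ 3 ≤ n)
    -- the variety `W` and the highest-weight components of the `L_t`
    (W : Set (Fin r → K))
    (hW : W = {a | ∀ i, MvPolynomial.eval (fun j : {j : Fin r // j ≠ k} => a j.1)
        (MvPolynomial.map (algebraMap Fq K) (L i)) = 0})
    (Lwt : Fin m → MvPolynomial {j : Fin r // j ≠ k} Fq)
    (hLwt : ∀ i, Lwt i = MvPolynomial.weightedHomogeneousComponent
        (fun j : {j : Fin r // j ≠ k} => r - (j.1 : ℕ))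
        (MvPolynomial.weightedTotalDegree
          (fun j : {j : Fin r // j ≠ k} => r - (j.1 : ℕ)) (L i)) (L i)) :
    -- (H1)
    (RingTheory.Sequence.IsRegular (MvPolynomial {j : Fin r // j ≠ k} Fq) (List.ofFn L))
    -- (H2)
    ∧ (∀ a ∈ W, Matrix.rank (Matrix.of fun (i : Fin m) (j : {j : Fin r // j ≠ k}) =>
          MvPolynomial.eval (fun j' : {j : Fin r // j ≠ k} => a j'.1)
            (MvPolynomial.pderiv j (MvPolynomial.map (algebraMap Fq K) (L i)))) = m)
    -- (H3)
    ∧ (RingTheory.Sequence.IsRegular (MvPolynomial {j : Fin r // j ≠ k} Fq) (List.ofFn Lwt))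
    ∧ (∀ a : Fin r → K,
          (∀ i, MvPolynomial.eval (fun j : {j : Fin r // j ≠ k} => a j.1)
            (MvPolynomial.map (algebraMap Fq K) (Lwt i)) = 0) →
          Matrix.rank (Matrix.of fun (i : Fin m) (j : {j : Fin r // j ≠ k}) =>
            MvPolynomial.eval (fun j' : {j : Fin r // j ≠ k} => a j'.1)
              (MvPolynomial.pderiv j (MvPolynomial.map (algebraMap Fq K) (Lwt i)))) = m)
    -- (H4)
    ∧ (dimOf K r {a | a ∈ W ∧ ¬ Squarefree (monicOfCoeffs r a)} + 1
        ≤ ((r - m : ℕ) : WithBot ℕ∞))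
    -- (H5)
    ∧ (dimOf K r
        ({a | a ∈ W ∧ ¬ Squarefree (monicOfCoeffs r a) ∧ a ⟨0, by omega⟩ = 0}
          ∪ {a | a ∈ W ∧ 2 ≤ (EuclideanDomain.gcd (monicOfCoeffs r a)
              (Polynomial.derivative (monicOfCoeffs r a))).degree}) + 2
        ≤ ((r - m : ℕ) : WithBot ℕ∞))
    -- (H6)
    ∧ (dimOf K r {a | (∀ i, MvPolynomial.eval (fun j : {j : Fin r // j ≠ k} => a j.1)
            (MvPolynomial.map (algebraMap Fq K) (Lwt i)) = 0)
            ∧ ¬ Squarefree (monicOfCoeffs r a)} + 1 ≤ ((r - m : ℕ) : WithBot ℕ∞)) := by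
  choose piv hpiv hne using hpivot
  have hpivn : ∀ t, n ≤ ((piv t).1 : ℕ) := fun t => by
    have := hidxup t
    rw [hpiv]
    omega
  have h : IsEchelonFamily L piv := by
    refine ⟨fun s t hst => hmono.injective ?_, hhom, fun t v hv => ?_, hne⟩
    · have hs := hidxup s
      have ht := hidxup t
      have hst' := hpiv s
      rw [hst, hpiv] at hst'
      omega
    · change ((piv t).1 : ℕ) ≤ v.1
      rw [hpiv]
      exact hvars t _ (MvPolynomial.mem_support_iff.mpr hv) v (by simp)
  have hwt : IsEchelonFamily Lwt piv := by
    rw [funext hLwt]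
    exact h.weightedHomogeneousComponent fun i j hij => Nat.sub_le_sub_left hij r
  have : IsAlgClosed K := IsAlgClosure.isAlgClosed Fq
  have hcast : ∀ l : ℕ, (l : K) = 0 → ringChar Fq ∣ l := fun l hl =>
    (ringChar.spec Fq l).mp ((algebraMap Fq K).injective (by simpa using hl))
  have hpiv₂ : ∀ t, 2 ≤ ((piv t).1 : ℕ) := fun t => hn2.trans (hpivn t)
  have hW' : ∀ a ∈ W, ∀ t, MvPolynomial.eval (fun j : {j : Fin r // j ≠ k} => a j.1)
      (MvPolynomial.map (algebraMap Fq K) (L t)) = 0 := fun a ha => by rwa [hW] at ha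
  have hcodim : ∀ {Z : Set (Fin r → K)} {c : ℕ}, c ≤ r - m → AlgDepOn (r - m - c) Z →
      dimOf K r Z + c ≤ ((r - m : ℕ) : WithBot ℕ∞) := fun {Z c} hc hZ => by
    calc dimOf K r Z + c ≤ ((r - m - c : ℕ) : WithBot ℕ∞) + c := by
          gcongr
          exact dimOf_le_of_algDepOn hZ
      _ = ((r - m : ℕ) : WithBot ℕ∞) := by exact_mod_cast Nat.sub_add_cancel hc
  refine ⟨h.isRegular, fun a _ => h.rank_jacobian fun j => a j.1, hwt.isRegular,
    fun a _ => hwt.rank_jacobian fun j => a j.1, ?_, ?_, ?_⟩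
  · have hsq : AlgDepOn (r - m - 1) {a | a ∈ W ∧ ¬ Squarefree (monicOfCoeffs r a)} :=
      (h.algDepOn_not_squarefree hk hpiv₂ (by omega)).mono fun a ha => ⟨hW' a ha.1, ha.2⟩
    exact_mod_cast hcodim (by omega) hsq
  · refine hcodim (c := 2) (by omega) ?_
    rcases hcase with ⟨rfl, hdvd⟩ | hn3
    · refine h.algDepOn_deeply_degenerate hk (fun h0 => hdvd ((hcast r h0).mul_right _))
        (fun h0 => hdvd (Dvd.dvd.mul_left (hcast (r - 1) ?_) _)) hpiv₂ hm (by omega) hW'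
      rw [Nat.cast_sub (by omega), Nat.cast_one, h0]
    · refine h.algDepOn_deeply_degenerate_of_three hk (fun h0 => ?_)
        (fun t => hn3.trans (hpivn t)) hm (by omega) hW'
      have := Nat.le_of_dvd two_pos (hcast 2 (by exact_mod_cast h0))
      omega
  · exact_mod_cast hcodim (by omega) (hwt.algDepOn_not_squarefree hk hpiv₂ (by omega))
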